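/- In S(F₃;ℂ), with α = g₃g₂⁻¹g₁g₂g₁⁻¹ and β = g₂⁻¹g₁g₂g₁⁻¹g₃, one has Φ(Q) = [αg₁g₂] − [βg₁g₂], where Q = −x₁²x₁₂₃ + x₂²x₁₂₃ + x₁x₁₂x₁₃ − x₂x₁₂x₂₃ − 2x₂x₁₃ + 2x₁x₂₃. -/

import Mathlib

open MvPolynomial

noncomputable section

def skeinIdeal (R G : Type*) [CommRing R] [Group G] : Ideal (MvPolynomial G R) :=
  Ideal.span ({X (1 : G) - 2} ∪
    {p | ∃ g h : G, p = X g * X h - X (g * h) - X (g * h⁻¹)})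

abbrev SkeinAlgebra (R G : Type*) [CommRing R] [Group G] :=
  MvPolynomial G R ⧸ skeinIdeal R G

def cl (R : Type*) {G : Type*} [CommRing R] [Group G] (g : G) : SkeinAlgebra R G :=
  Ideal.Quotient.mk (skeinIdeal R G) (X g)

/-- The free group on three generators. -/
abbrev F3 := FreeGroup (Fin 3)

def g1 : F3 := FreeGroup.of 0
def g2 : F3 := FreeGroup.of 1
def g3 : F3 := FreeGroup.of 2

/-- The words `g₁, g₂, g₃, g₁g₂, g₁g₃, g₂g₃, g₁g₂g₃` indexed by the seven variables
`x₁, x₂, x₃, x₁₂, x₁₃, x₂₃, x₁₂₃`. -/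
def word : Fin 7 → F3 := ![g1, g2, g3, g1 * g2, g1 * g3, g2 * g3, g1 * g2 * g3]

/-- `Φ : ℂ[x₁,…,x₁₂₃] → S(F₃;ℂ)`, `x_{i₁⋯i_k} ↦ [g_{i₁}⋯g_{i_k}]`. -/
def Phi : MvPolynomial (Fin 7) ℂ →ₐ[ℂ] SkeinAlgebra ℂ F3 :=
  aeval fun i => cl ℂ (word i)

-- the seven variables
def x1 : MvPolynomial (Fin 7) ℂ := X 0
def x2 : MvPolynomial (Fin 7) ℂ := X 1
def x3 : MvPolynomial (Fin 7) ℂ := X 2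
def x12 : MvPolynomial (Fin 7) ℂ := X 3
def x13 : MvPolynomial (Fin 7) ℂ := X 4
def x23 : MvPolynomial (Fin 7) ℂ := X 5
def x123 : MvPolynomial (Fin 7) ℂ := X 6

/-- The polynomial `K`. -/
def K : MvPolynomial (Fin 7) ℂ :=
  x123 ^ 2 - (x12 * x3 + x13 * x2 + x23 * x1 - x1 * x2 * x3) * x123
    + x1 ^ 2 + x2 ^ 2 + x3 ^ 2 + x12 ^ 2 + x23 ^ 2 + x13 ^ 2
    - x1 * x2 * x12 - x1 * x3 * x13 - x2 * x3 * x23 + x12 * x13 * x23 - 4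

def ralpha : F3 := g3 * g2⁻¹ * g1 * g2 * g1⁻¹
def rbeta : F3 := g2⁻¹ * g1 * g2 * g1⁻¹ * g3

def Q : MvPolynomial (Fin 7) ℂ :=
  -(x1^2*x123) + x2^2*x123 + x1*x12*x13 - x2*x12*x23 - 2*x2*x13 + 2*x1*x23

section SkeinRelations

variable {R G : Type*} [CommRing R] [Group G]

lemma cl_mul_cl (g h : G) : cl R g * cl R h = cl R (g * h) + cl R (g * h⁻¹) := by
  have hmem : (X g * X h - X (g * h) - X (g * h⁻¹) : MvPolynomial G R) ∈ skeinIdeal R G :=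
    Ideal.subset_span (Or.inr ⟨g, h, rfl⟩)
  have hzero := Ideal.Quotient.eq_zero_iff_mem.mpr hmem
  simp only [map_sub, map_mul] at hzero
  unfold cl
  linear_combination hzero

lemma cl_one : cl R (1 : G) = 2 := by
  have hmem : (X (1 : G) - 2 : MvPolynomial G R) ∈ skeinIdeal R G :=
    Ideal.subset_span (Or.inl rfl)
  have hzero := Ideal.Quotient.eq_zero_iff_mem.mpr hmem
  simp only [map_sub, map_ofNat] at hzero
  exact sub_eq_zero.mp hzero

lemma cl_inv (g : G) : cl R g⁻¹ = cl R g := by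
  have h := cl_mul_cl (R := R) 1 g
  rw [cl_one, one_mul, one_mul] at h
  linear_combination -h

lemma cl_mul_comm (g h : G) : cl R (g * h) = cl R (h * g) := by
  have hgh := cl_mul_cl (R := R) g h
  have hhg := cl_mul_cl (R := R) h g
  have hinv := cl_inv (R := R) (g * h⁻¹)
  rw [mul_inv_rev, inv_inv] at hinv
  linear_combination hhg - hgh + hinv

lemma cl_mul (g h : G) : cl R (g * h) = cl R g * cl R h - cl R (g * h⁻¹) := by
  rw [cl_mul_cl, add_sub_cancel_right]

lemma cl_mul_inv (g h : G) : cl R (g * h⁻¹) = cl R g * cl R h - cl R (g * h) := by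
  rw [cl_mul_cl, add_sub_cancel_left]

lemma cl_mul_mul_mul (a b c : G) :
    cl R (a * b * (c * b)) =
      cl R (a * b) * cl R (b * c) - cl R a * cl R c + cl R (a * c) := by
  have h : a * b * (c * b)⁻¹ = a * c⁻¹ := by group
  rw [cl_mul, h, cl_mul_inv, cl_mul_comm c b]
  ring

lemma cl_mul_conj (a b c : G) :
    cl R (a * b * c * b⁻¹) =
      cl R (a * b * c) * cl R b - cl R (a * b) * cl R (b * c)
        + cl R a * cl R c - cl R (a * c) := by
  rw [cl_mul_inv, mul_assoc (a * b) c b, cl_mul_mul_mul]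
  ring

end SkeinRelations

lemma cl_ralpha_mul_g1_mul_g2 :
    cl ℂ (ralpha * g1 * g2) =
      (cl ℂ (g1 * g2 * g3) * cl ℂ g2 - cl ℂ (g1 * g2) * cl ℂ (g2 * g3)
        + cl ℂ g1 * cl ℂ g3 - cl ℂ (g1 * g3)) * cl ℂ g2
        - cl ℂ (g1 * g3) * cl ℂ g2 + cl ℂ (g1 * g3 * g2) := by
  have hword : ralpha * g1 * g2 = g3 * g2⁻¹ * (g1 * g2) * g2 := by
    unfold ralpha
    group
  have hcancel : g3 * g2⁻¹ * (g1 * g2) * g2⁻¹ = g3 * g2⁻¹ * g1 := by group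
  rw [hword, cl_mul, hcancel, cl_mul_comm (g3 * g2⁻¹) (g1 * g2),
    cl_mul_comm (g3 * g2⁻¹) g1, ← mul_assoc, ← mul_assoc, cl_mul_conj, cl_mul_inv]
  ring

lemma cl_rbeta_mul_g1_mul_g2 :
    cl ℂ (rbeta * g1 * g2) =
      (cl ℂ (g1 * g2 * g3) * cl ℂ g1 - cl ℂ (g1 * g3) * cl ℂ (g1 * g2)
        + cl ℂ g3 * cl ℂ g2 - cl ℂ (g2 * g3)) * cl ℂ g1
        - cl ℂ (g2 * g3) * cl ℂ g1 + cl ℂ (g1 * g3 * g2) := by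
  have hword : rbeta * g1 * g2 = g2⁻¹ * (g1 * g2 * g1⁻¹ * g3 * g1 * g2) := by
    unfold rbeta
    group
  have hconj : g1 * g2 * g1⁻¹ * g3 * g1 * g2 * g2⁻¹ = g1 * g2 * g1⁻¹ * g3 * g1 := by group
  have hcancel : g1⁻¹ * (g1 * g2 * g1⁻¹ * g3) = g2 * g1⁻¹ * g3 := by group
  rw [hword, cl_mul_comm g2⁻¹, hconj, cl_mul,
    cl_mul_comm (g1 * g2 * g1⁻¹ * g3) g1⁻¹, hcancel,
    cl_mul_comm (g1 * g2 * g1⁻¹) g3, cl_mul_comm (g2 * g1⁻¹) g3,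
    ← mul_assoc, ← mul_assoc, ← mul_assoc, cl_mul_conj, cl_mul_inv,
    cl_mul_comm g3 g2, cl_mul_comm g3 g1, mul_assoc g3 g1 g2, cl_mul_comm g3 (g1 * g2),
    mul_assoc g1 g3 g2, cl_mul_comm g1 (g3 * g2)]
  ring

theorem phi_Q_alpha_g1g2 : Phi Q = cl ℂ (ralpha * g1 * g2) - cl ℂ (rbeta * g1 * g2) := by
  rw [cl_ralpha_mul_g1_mul_g2, cl_rbeta_mul_g1_mul_g2]
  simp only [Phi, Q, x1, x2, x12, x13, x23, x123, map_add, map_sub, map_neg, map_mul, map_pow,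
    map_ofNat, aeval_X]
  simp only [word, Matrix.cons_val]
  ring
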